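/- Let ω be an infinite word which is either aperiodic or periodic (ω = v_0 v_0 v_0 ⋯ with v_0 ∈ F_n^+ primitive), and let T = (T_1,…,T_n) be a bilateral weighted shift on K_ω with bounded weights Λ = {λ_u}_{u∈F_ω} satisfying λ_u > 0 for all u. Then the family {T_1,…,T_n} has a non-trivial joint reducing subspace if and only if ω is periodic and there exists an integer k ≥ 1 such that λ_{u v_0^k} = λ_u for every u ∈ F_ω. -/

import Mathlib

open scoped ENNReal InnerProductSpace

noncomputable section

variable {n : ℕ}

/-- The element of the free group determined by a word (list of generators). -/
def wordProd (l : List (Fin n)) : FreeGroup (Fin n) := (l.map FreeGroup.of).prod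

/-- The initial segment `ω_m = i_1 i_2 ⋯ i_m` of an infinite word `ω`. -/
def initSeg (ω : ℕ → Fin n) (m : ℕ) : List (Fin n) := List.ofFn fun j : Fin m => ω j

/-- The set `F_ω = { v ω_m⁻¹ : v ∈ F_n^+, m ≥ 0 }` inside the free group. -/
def Fomega (ω : ℕ → Fin n) : Set (FreeGroup (Fin n)) :=
  {g | ∃ (v : List (Fin n)) (m : ℕ), g = wordProd v * (wordProd (initSeg ω m))⁻¹}

lemma genMul_mem (ω : ℕ → Fin n) (i : Fin n) {g : FreeGroup (Fin n)} (hg : g ∈ Fomega ω) :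
    FreeGroup.of i * g ∈ Fomega ω := by
  obtain ⟨v, m, rfl⟩ := hg
  exact ⟨i :: v, m, by simp [wordProd, mul_assoc]⟩

/-- `K_ω = ℓ²(F_ω)`. -/
abbrev Komega (ω : ℕ → Fin n) : Type _ := lp (fun _ : Fomega ω => ℂ) 2

/-- The standard orthonormal basis vector `ξ_u` of `K_ω`. -/
def xi (ω : ℕ → Fin n) (u : Fomega ω) : Komega ω := lp.single 2 u 1

/-- `iu` as an element of `F_ω`. -/
def gen (ω : ℕ → Fin n) (i : Fin n) (u : Fomega ω) : Fomega ω :=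
  ⟨FreeGroup.of i * u.1, genMul_mem ω i u.2⟩

/-- `T = (T_1,…,T_n)` is the bilateral weighted shift on `K_ω` with (complex) weights `Λ`:
`T_i ξ_u = λ_{iu} ξ_{iu}`. -/
def IsWeightedShift (ω : ℕ → Fin n) (Λ : Fomega ω → ℂ)
    (T : Fin n → Komega ω →L[ℂ] Komega ω) : Prop :=
  ∀ (i : Fin n) (u : Fomega ω), T i (xi ω u) = Λ (gen ω i u) • xi ω (gen ω i u)

/-- real-weight version -/
def IsWeightedShiftR (ω : ℕ → Fin n) (Λ : Fomega ω → ℝ)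
    (T : Fin n → Komega ω →L[ℂ] Komega ω) : Prop :=
  ∀ (i : Fin n) (u : Fomega ω), T i (xi ω u) = (Λ (gen ω i u) : ℂ) • xi ω (gen ω i u)

/-- A closed subspace `H` is reducing for an operator `A` if `H` and `Hᗮ` are `A`-invariant. -/
def Reduces {E : Type*} [NormedAddCommGroup E] [InnerProductSpace ℂ E]
    (A : E →L[ℂ] E) (H : Submodule ℂ E) : Prop :=
  (∀ x ∈ H, A x ∈ H) ∧ ∀ x ∈ Hᗮ, A x ∈ Hᗮ

/-- `w^k` for a finite word `w`. -/
def listPow (w : List (Fin n)) : ℕ → List (Fin n)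
  | 0 => []
  | k + 1 => w ++ listPow w k

/-- A word is primitive if it is non-empty and not a proper power. -/
def Primitive (v : List (Fin n)) : Prop :=
  v ≠ [] ∧ ∀ (w : List (Fin n)) (j : ℕ), 2 ≤ j → v ≠ listPow w j

/-- `ω = v v v ⋯`. -/
def IsPeriodicWord (ω : ℕ → Fin n) (v : List (Fin n)) : Prop :=
  v ≠ [] ∧ ∀ k : ℕ, initSeg ω (k * v.length) = listPow v k

/-- `ω = u v₀ v₀ v₀ ⋯` for some words `u, v₀` with `v₀` non-empty. -/
def EventuallyPeriodic (ω : ℕ → Fin n) : Prop :=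
  ∃ N p : ℕ, 1 ≤ p ∧ ∀ m ≥ N, ω (m + p) = ω m

def Aperiodic (ω : ℕ → Fin n) : Prop := ¬EventuallyPeriodic ω

section Words

lemma wordProd_append (l l' : List (Fin n)) : wordProd (l ++ l') = wordProd l * wordProd l' := by
  simp [wordProd]

lemma wordProd_cons (i : Fin n) (l : List (Fin n)) :
    wordProd (i :: l) = FreeGroup.of i * wordProd l := by
  simp [wordProd]

lemma toWord_wordProd (l : List (Fin n)) : (wordProd l).toWord = l.map fun i => (i, true) := by
  have hmk : wordProd l = FreeGroup.mk (l.map fun i => (i, true)) := by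
    induction l with
    | nil => rfl
    | cons i l ih => rw [wordProd_cons, ih, FreeGroup.of, FreeGroup.mul_mk]; rfl
  have hred : FreeGroup.IsReduced (l.map fun i => (i, true)) := by
    rw [FreeGroup.IsReduced, List.isChain_map]
    exact (List.pairwise_of_forall fun _ _ _ => rfl).isChain
  rw [hmk, FreeGroup.toWord_mk, hred.reduce_eq]

lemma wordProd_injective : Function.Injective (wordProd (n := n)) := by
  intro l l' h
  have h' := congrArg FreeGroup.toWord h
  rw [toWord_wordProd, toWord_wordProd] at h'
  exact (List.map_injective_iff.2 fun a b hab => (Prod.mk.inj hab).1) h'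

lemma length_initSeg (ω : ℕ → Fin n) (m : ℕ) : (initSeg ω m).length = m := by
  simp [initSeg]

lemma initSeg_succ (ω : ℕ → Fin n) (m : ℕ) : initSeg ω (m + 1) = initSeg ω m ++ [ω m] := by
  rw [initSeg, List.ofFn_succ_last]
  rfl

lemma take_initSeg (ω : ℕ → Fin n) (m a : ℕ) : (initSeg ω (m + a)).take m = initSeg ω m := by
  induction a with
  | zero => rw [Nat.add_zero, List.take_of_length_le (length_initSeg ω m).le]
  | succ a ih =>
    rw [← Nat.add_assoc, initSeg_succ, List.take_append_of_le_length (by rw [length_initSeg]; omega),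
      ih]

lemma listPow_add (w : List (Fin n)) (a b : ℕ) :
    listPow w (a + b) = listPow w a ++ listPow w b := by
  induction a with
  | zero => simp [listPow]
  | succ a ih => rw [Nat.add_right_comm]; simp [listPow, ih]

lemma IsPeriodicWord.initSeg_add {ω : ℕ → Fin n} {v : List (Fin n)} (h : IsPeriodicWord ω v)
    (k m : ℕ) : initSeg ω (k * v.length + m) = listPow v k ++ initSeg ω m := by
  have hv : 1 ≤ v.length := List.length_pos_iff.2 h.1
  obtain ⟨a, ha⟩ : ∃ a, m * v.length = m + a := Nat.exists_eq_add_of_le (by nlinarith)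
  have hlen : (listPow v k).length = k * v.length := by rw [← h.2 k, length_initSeg]
  rw [← take_initSeg ω (k * v.length + m) a,
    show k * v.length + m + a = (k + m) * v.length by rw [Nat.add_mul, ha]; ring,
    h.2, listPow_add, ← hlen, List.take_length_add_append, ← h.2 m, ha, take_initSeg]

end Words

/-- The element `v ω_m⁻¹` of `F_ω`. -/
def frac (ω : ℕ → Fin n) (v : List (Fin n)) (m : ℕ) : Fomega ω :=
  ⟨wordProd v * (wordProd (initSeg ω m))⁻¹, v, m, rfl⟩

section Frac

variable {ω : ℕ → Fin n}

lemma gen_frac (i : Fin n) (v : List (Fin n)) (m : ℕ) :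
    gen ω i (frac ω v m) = frac ω (i :: v) m := by
  ext1
  simp [gen, frac, wordProd_cons, mul_assoc]

lemma frac_succ (v : List (Fin n)) (m : ℕ) : frac ω (v ++ [ω m]) (m + 1) = frac ω v m := by
  ext1
  simp [frac, initSeg_succ, wordProd_append, mul_assoc]

lemma exists_frac_add (v : List (Fin n)) (m a : ℕ) :
    ∃ v', v'.length = v.length + a ∧ frac ω v m = frac ω v' (m + a) := by
  induction a with
  | zero => exact ⟨v, rfl, rfl⟩
  | succ a ih =>
    obtain ⟨v', hl, h⟩ := ih
    exact ⟨v' ++ [ω (m + a)], by simp [hl, Nat.add_assoc], by rw [h, ← frac_succ, Nat.add_assoc]⟩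

lemma exists_eq_frac (u : Fomega ω) : ∃ v m, u = frac ω v m := by
  obtain ⟨g, v, m, rfl⟩ := u
  exact ⟨v, m, rfl⟩

/-- Every element of `F_ω` is a fraction with arbitrarily long numerator and denominator. -/
lemma exists_eq_frac_add (u : Fomega ω) (N : ℕ) :
    ∃ v m, v ≠ [] ∧ u = frac ω v (N + m) := by
  obtain ⟨v, m, rfl⟩ := exists_eq_frac u
  obtain ⟨v', hl, h⟩ := exists_frac_add (ω := ω) v m (N + 1)
  refine ⟨v', m + 1, fun h0 => ?_, by rw [h]; congr 1; omega⟩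
  simp [h0] at hl

lemma frac_injective (m : ℕ) : Function.Injective fun v => frac ω v m := fun _ _ h =>
  wordProd_injective (mul_right_cancel (congrArg Subtype.val h))

lemma gen_injective (i : Fin n) : Function.Injective (gen ω i) := fun _ _ h =>
  Subtype.ext (mul_left_cancel (congrArg Subtype.val h))

lemma eq_of_gen_eq_gen {i j : Fin n} {u u' : Fomega ω} (h : gen ω i u = gen ω j u') : i = j := by
  obtain ⟨v, m, rfl⟩ := exists_eq_frac u
  obtain ⟨v', m', rfl⟩ := exists_eq_frac u'
  obtain ⟨w, -, hw⟩ := exists_frac_add (ω := ω) v m m'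
  obtain ⟨w', -, hw'⟩ := exists_frac_add (ω := ω) v' m' m
  rw [hw, hw', gen_frac, gen_frac, Nat.add_comm m' m] at h
  exact (List.cons.inj (frac_injective _ h)).1

lemma IsPeriodicWord.frac_mul {v₀ : List (Fin n)} (h : IsPeriodicWord ω v₀) (v : List (Fin n))
    (k m : ℕ) :
    (frac ω v (m + k * v₀.length)).1 * wordProd (listPow v₀ k) = (frac ω v m).1 := by
  simp [frac, Nat.add_comm m, h.initSeg_add, wordProd_append, mul_assoc]

lemma IsPeriodicWord.mul_mem {v₀ : List (Fin n)} (h : IsPeriodicWord ω v₀) (k : ℕ) (u : Fomega ω) :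
    u.1 * wordProd (listPow v₀ k) ∈ Fomega ω := by
  obtain ⟨v, m, -, rfl⟩ := exists_eq_frac_add u (k * v₀.length)
  rw [Nat.add_comm, h.frac_mul]
  exact (frac ω v m).2

lemma IsPeriodicWord.mul_inv_mem {v₀ : List (Fin n)} (h : IsPeriodicWord ω v₀) (k : ℕ)
    (u : Fomega ω) : u.1 * (wordProd (listPow v₀ k))⁻¹ ∈ Fomega ω := by
  obtain ⟨v, m, rfl⟩ := exists_eq_frac u
  rw [← h.frac_mul v k m, mul_inv_cancel_right]
  exact (frac ω v _).2

/-- Right multiplication by `v₀ ^ k` as a permutation of `F_ω`. -/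
def rightMulPerm {v₀ : List (Fin n)} (h : IsPeriodicWord ω v₀) (k : ℕ) :
    Equiv.Perm (Fomega ω) where
  toFun u := ⟨u.1 * wordProd (listPow v₀ k), h.mul_mem k u⟩
  invFun u := ⟨u.1 * (wordProd (listPow v₀ k))⁻¹, h.mul_inv_mem k u⟩
  left_inv u := by simp
  right_inv u := by simp

lemma rightMulPerm_ne {v₀ : List (Fin n)} (h : IsPeriodicWord ω v₀) {k : ℕ} (hk : 1 ≤ k)
    (u : Fomega ω) : rightMulPerm h k u ≠ u := by
  intro hu
  have h1 : wordProd (listPow v₀ k) = 1 := mul_eq_left.1 (congrArg Subtype.val hu)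
  have h2 : listPow v₀ k = [] := wordProd_injective h1
  obtain ⟨k, rfl⟩ := Nat.exists_eq_add_of_le' hk
  exact h.1 (List.append_eq_nil_iff.1 h2).1

lemma rightMulPerm_gen {v₀ : List (Fin n)} (h : IsPeriodicWord ω v₀) (k : ℕ) (i : Fin n)
    (u : Fomega ω) : rightMulPerm h k (gen ω i u) = gen ω i (rightMulPerm h k u) :=
  Subtype.ext (mul_assoc _ _ _)

end Frac

section Basis

variable {ω : ℕ → Fin n}

lemma inner_xi_left (u : Fomega ω) (x : Komega ω) : ⟪xi ω u, x⟫_ℂ = x u := by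
  rw [xi, lp.inner_single_left]
  simp

lemma inner_xi_xi (u u' : Fomega ω) : ⟪xi ω u, xi ω u'⟫_ℂ = if u = u' then 1 else 0 := by
  rw [inner_xi_left, xi, lp.single_apply, Pi.single_apply]

lemma ext_inner_xi {x y : Komega ω} (h : ∀ u, ⟪xi ω u, x⟫_ℂ = ⟪xi ω u, y⟫_ℂ) : x = y := by
  ext u
  rw [← inner_xi_left, ← inner_xi_left, h]

lemma orthogonal_span_range_xi : (Submodule.span ℂ (Set.range (xi ω)))ᗮ = ⊥ := by
  rw [eq_bot_iff]
  intro x hx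
  rw [Submodule.mem_bot]
  refine ext_inner_xi fun u => ?_
  rw [inner_zero_right]
  exact (Submodule.mem_orthogonal _ _).1 hx _ (Submodule.subset_span ⟨u, rfl⟩)

lemma dense_span_range_xi : Dense (Submodule.span ℂ (Set.range (xi ω)) : Set (Komega ω)) := by
  rw [Submodule.dense_iff_topologicalClosure_eq_top, Submodule.topologicalClosure_eq_top_iff]
  exact orthogonal_span_range_xi

lemma ext_xi {A B : Komega ω →L[ℂ] Komega ω} (h : ∀ u, A (xi ω u) = B (xi ω u)) : A = B := by
  refine ContinuousLinearMap.ext_on dense_span_range_xi ?_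
  rintro _ ⟨u, rfl⟩
  exact h u

lemma orthonormal_xi : Orthonormal ℂ (xi ω) := by
  rw [orthonormal_iff_ite]
  exact inner_xi_xi

/-- There is a unitary of `K_ω` permuting the standard basis by `σ`. -/
lemma exists_unitary_perm (σ : Equiv.Perm (Fomega ω)) :
    ∃ U : Komega ω →L[ℂ] Komega ω, star U * U = 1 ∧ U * star U = 1 ∧
      ∀ u, U (xi ω u) = xi ω (σ u) := by
  have hsp : (Submodule.span ℂ (Set.range (xi ω ∘ σ)))ᗮ = ⊥ := by
    rw [σ.surjective.range_comp]
    exact orthogonal_span_range_xi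
  let b := HilbertBasis.mkOfOrthogonalEqBot (orthonormal_xi.comp σ σ.injective) hsp
  have hmem := (Unitary.linearIsometryEquiv.symm b.repr.symm).2
  refine ⟨_, (Unitary.mem_iff.1 hmem).1, (Unitary.mem_iff.1 hmem).2, fun u => ?_⟩
  have h1 : b.repr.symm (xi ω u) = b u := b.repr_symm_single u
  have h2 : b u = xi ω (σ u) :=
    congrFun (HilbertBasis.coe_mkOfOrthogonalEqBot (orthonormal_xi.comp σ σ.injective) hsp) u
  exact h1.trans h2

end Basis

section Reducing

variable {E : Type*} [NormedAddCommGroup E] [InnerProductSpace ℂ E] [CompleteSpace E]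

lemma reduces_ker_of_commute {A B : E →L[ℂ] E} (h : Commute A B) (h' : Commute (star A) B) :
    Reduces A (LinearMap.ker (B : E →ₗ[ℂ] E)) := by
  have key : ∀ C : E →L[ℂ] E, Commute C B → ∀ x, B x = 0 → B (C x) = 0 := fun C hC x hx => by
    have := DFunLike.congr_fun hC.eq x
    simp only [mul_apply_eq_comp, hx, map_zero] at this
    exact this.symm
  refine ⟨fun x hx => key A h x hx, fun x hx => ?_⟩
  rw [Submodule.mem_orthogonal] at hx ⊢
  intro y hy
  rw [← ContinuousLinearMap.adjoint_inner_left]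
  exact hx _ (key _ h' y hy)

lemma eq_zero_of_nonneg_of_inner_eq_zero {ι : Type*} {e : ι → E}
    (he : Dense (Submodule.span ℂ (Set.range e) : Set E)) {A : E →L[ℂ] E} (hA : 0 ≤ A)
    (h : ∀ u, ⟪e u, A (e u)⟫_ℂ = 0) : A = 0 := by
  obtain ⟨C, rfl⟩ := CStarAlgebra.nonneg_iff_eq_star_mul_self.1 hA
  refine ContinuousLinearMap.ext_on he ?_
  rintro _ ⟨u, rfl⟩
  have hC : C (e u) = 0 := by
    rw [← inner_self_eq_zero (𝕜 := ℂ), ← ContinuousLinearMap.adjoint_inner_right]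
    exact h u
  rw [mul_apply_eq_comp, hC]
  simp

/-- A non-zero self-adjoint operator with zero diagonal with respect to a total family is neither
positive nor negative, so that the kernel of its positive part is a non-trivial subspace. -/
lemma exists_reducing_of_isSelfAdjoint {ι : Type*} {e : ι → E}
    (he : Dense (Submodule.span ℂ (Set.range e) : Set E)) {A : E →L[ℂ] E} (hA : IsSelfAdjoint A)
    (hA0 : A ≠ 0) (hdiag : ∀ u, ⟪e u, A (e u)⟫_ℂ = 0) :
    ∃ H : Submodule ℂ E, IsClosed (H : Set E) ∧ H ≠ ⊥ ∧ H ≠ ⊤ ∧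
      ∀ B : E →L[ℂ] E, Commute A B → Commute A (star B) → Reduces B H := by
  have hsub : A⁺ - A⁻ = A := CFC.posPart_sub_negPart A
  have hpos : A⁺ ≠ 0 := fun h0 => hA0 <| by
    rw [h0, zero_sub] at hsub
    have : A⁻ = 0 := eq_zero_of_nonneg_of_inner_eq_zero he (CFC.negPart_nonneg A) fun u => by
      rw [← neg_eq_iff_eq_neg.2 hsub.symm, neg_apply, inner_neg_right, hdiag, neg_zero]
    rw [← hsub, this, neg_zero]
  have hneg : A⁻ ≠ 0 := fun h0 => hA0 <| by
    rw [h0, sub_zero] at hsub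
    exact eq_zero_of_nonneg_of_inner_eq_zero he (hsub ▸ CFC.posPart_nonneg A) hdiag
  refine ⟨LinearMap.ker ((A⁺ : E →L[ℂ] E) : E →ₗ[ℂ] E), ContinuousLinearMap.isClosed_ker _,
    fun hbot => hneg ?_, fun htop => hpos ?_, fun B hB hB' =>
      reduces_ker_of_commute (hB.cfcₙ_real _).symm (hB'.cfcₙ_real _).symm⟩
  · ext1 x
    have hx : A⁻ x ∈ LinearMap.ker ((A⁺ : E →L[ℂ] E) : E →ₗ[ℂ] E) :=
      DFunLike.congr_fun (CFC.posPart_mul_negPart A) x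
    rw [hbot] at hx
    exact hx
  · ext1 x
    have hx : x ∈ (⊤ : Submodule ℂ E) := Submodule.mem_top
    rw [← htop] at hx
    exact hx

end Reducing

lemma starProjection_apply_of_reduces {E : Type*} [NormedAddCommGroup E] [InnerProductSpace ℂ E]
    {A : E →L[ℂ] E} {H : Submodule ℂ E}
    [H.HasOrthogonalProjection] (h : Reduces A H) (x : E) :
    H.starProjection (A x) = A (H.starProjection x) := by
  have hx : A x = A (H.starProjection x) + A (x - H.starProjection x) := by
    rw [← map_add, add_sub_cancel]
  refine Submodule.eq_starProjection_of_mem_orthogonal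
    (h.1 _ (Submodule.starProjection_apply_mem H x)) ?_
  rw [← map_sub]
  exact h.2 _ (Submodule.sub_starProjection_mem_orthogonal x)

section Shift

variable {ω : ℕ → Fin n} {Λ : Fomega ω → ℝ} {T : Fin n → Komega ω →L[ℂ] Komega ω}

lemma IsWeightedShiftR.inner_gen (hT : IsWeightedShiftR ω Λ T) (i : Fin n) (u : Fomega ω)
    (x : Komega ω) : ⟪xi ω (gen ω i u), T i x⟫_ℂ = Λ (gen ω i u) * ⟪xi ω u, x⟫_ℂ := by
  have h : star (T i) (xi ω (gen ω i u)) = (Λ (gen ω i u) : ℂ) • xi ω u := by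
    refine ext_inner_xi fun w => ?_
    rw [ContinuousLinearMap.star_eq_adjoint, ContinuousLinearMap.adjoint_inner_right, hT,
      inner_smul_left, inner_smul_right, inner_xi_xi, inner_xi_xi]
    by_cases hw : w = u
    · simp [hw]
    · rw [if_neg hw, if_neg ((gen_injective i).ne hw), mul_zero, mul_zero]
  rw [← ContinuousLinearMap.adjoint_inner_left, ← ContinuousLinearMap.star_eq_adjoint, h,
    inner_smul_left, Complex.conj_ofReal]

lemma IsWeightedShiftR.inner_of_forall_ne (hT : IsWeightedShiftR ω Λ T) (i : Fin n)
    {g : Fomega ω} (hg : ∀ u, gen ω i u ≠ g) (x : Komega ω) : ⟪xi ω g, T i x⟫_ℂ = 0 := by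
  have h : star (T i) (xi ω g) = 0 := by
    refine ext_inner_xi fun w => ?_
    rw [ContinuousLinearMap.star_eq_adjoint, ContinuousLinearMap.adjoint_inner_right, hT,
      inner_smul_left, inner_xi_xi, if_neg (hg w), mul_zero, inner_zero_right]
  rw [← ContinuousLinearMap.adjoint_inner_left, ← ContinuousLinearMap.star_eq_adjoint, h,
    inner_zero_left]

/-- The properties needed of the matrix coefficients of a self-adjoint operator commuting with a
weighted shift. -/
structure IsShiftKernel (ω : ℕ → Fin n) (Λ : Fomega ω → ℝ)
    (p : Fomega ω → Fomega ω → ℂ) : Prop where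
  gen_gen : ∀ i u u', p (gen ω i u) (gen ω i u') = p u u'
  weight_eq : ∀ i u u', p u u' ≠ 0 → Λ (gen ω i u) = Λ (gen ω i u')
  eq_of_ne_zero : ∀ i j u u', p (gen ω i u) (gen ω j u') ≠ 0 → i = j

lemma IsWeightedShiftR.isShiftKernel (hT : IsWeightedShiftR ω Λ T) (hpos : ∀ u, 0 < Λ u)
    {P : Komega ω →L[ℂ] Komega ω} (hP : ∀ x y, ⟪P x, y⟫_ℂ = ⟪x, P y⟫_ℂ)
    (hPT : ∀ i x, P (T i x) = T i (P x)) :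
    IsShiftKernel ω Λ fun u u' => ⟪xi ω u, P (xi ω u')⟫_ℂ := by
  have hne : ∀ u, (Λ u : ℂ) ≠ 0 := fun u => Complex.ofReal_ne_zero.2 (hpos u).ne'
  have hconj : ∀ u u', ⟪xi ω u, P (xi ω u')⟫_ℂ = (starRingEnd ℂ) ⟪xi ω u', P (xi ω u)⟫_ℂ :=
    fun u u' => by rw [inner_conj_symm, hP]
  have h1 : ∀ i u u', (Λ (gen ω i u') : ℂ) * ⟪xi ω (gen ω i u), P (xi ω (gen ω i u'))⟫_ℂ =
      Λ (gen ω i u) * ⟪xi ω u, P (xi ω u')⟫_ℂ := fun i u u' => by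
    rw [← hT.inner_gen, ← hPT, hT, map_smul, inner_smul_right]
  have h2 : ∀ i u u', (Λ (gen ω i u) : ℂ) * ⟪xi ω (gen ω i u), P (xi ω (gen ω i u'))⟫_ℂ =
      Λ (gen ω i u') * ⟪xi ω u, P (xi ω u')⟫_ℂ := fun i u u' => by
    rw [hconj (gen ω i u), hconj u, ← Complex.conj_ofReal (Λ (gen ω i u)),
      ← Complex.conj_ofReal (Λ (gen ω i u')), ← map_mul, ← map_mul, h1]
  have hw : ∀ i u u', ⟪xi ω u, P (xi ω u')⟫_ℂ ≠ 0 → Λ (gen ω i u) = Λ (gen ω i u') := by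
    intro i u u' h0
    have h3 : ((Λ (gen ω i u) : ℂ) ^ 2) = (Λ (gen ω i u') : ℂ) ^ 2 := by
      apply mul_right_cancel₀ h0
      linear_combination (Λ (gen ω i u') : ℂ) * h2 i u u' - (Λ (gen ω i u) : ℂ) * h1 i u u'
    exact (pow_left_inj₀ (hpos _).le (hpos _).le two_ne_zero).1 (by exact_mod_cast h3)
  refine ⟨fun i u u' => ?_, hw, fun i j u u' h0 => ?_⟩
  · by_cases h0 : ⟪xi ω u, P (xi ω u')⟫_ℂ = 0
    · have := h1 i u u'
      rw [h0, mul_zero] at this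
      rw [h0, (mul_eq_zero.1 this).resolve_left (hne _)]
    · have := h1 i u u'
      rw [hw i u u' h0] at this
      exact mul_left_cancel₀ (hne _) this
  · by_contra hij
    have h3 : (Λ (gen ω j u') : ℂ) * ⟪xi ω (gen ω i u), P (xi ω (gen ω j u'))⟫_ℂ = 0 := by
      rw [← inner_smul_right, ← map_smul, ← hT, hPT]
      exact hT.inner_of_forall_ne j (fun w hw => hij (eq_of_gen_eq_gen hw).symm) _
    exact h0 ((mul_eq_zero.1 h3).resolve_left (hne _))

namespace IsShiftKernel

variable {p : Fomega ω → Fomega ω → ℂ}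

lemma frac_frac (hp : IsShiftKernel ω Λ p) (v : List (Fin n)) (m m' : ℕ) :
    p (frac ω v m) (frac ω v m') = p (frac ω [] m) (frac ω [] m') := by
  induction v with
  | nil => rfl
  | cons i v ih => rw [← gen_frac, ← gen_frac, hp.gen_gen, ih]

lemma eq_of_length_eq (hp : IsShiftKernel ω Λ p) {m m' : ℕ} {v v' : List (Fin n)}
    (hl : v.length = v'.length) (h : p (frac ω v m) (frac ω v' m') ≠ 0) : v = v' := by
  induction v generalizing v' with
  | nil => exact (List.length_eq_zero_iff.1 hl.symm).symm
  | cons i v ih =>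
    cases v' with
    | nil => simp at hl
    | cons j v' =>
      rw [← gen_frac, ← gen_frac] at h
      obtain rfl := hp.eq_of_ne_zero _ _ _ _ h
      rw [hp.gen_gen] at h
      rw [ih (by simpa using hl) h]

lemma exists_offDiag (hp : IsShiftKernel ω Λ p) {u u' : Fomega ω} (hne : u ≠ u')
    (h : p u u' ≠ 0) : ∃ m m', m ≠ m' ∧ p (frac ω [] m) (frac ω [] m') ≠ 0 := by
  obtain ⟨v, m, rfl⟩ := exists_eq_frac u
  obtain ⟨v', m', rfl⟩ := exists_eq_frac u'
  obtain ⟨w, hl, hw⟩ := exists_frac_add (ω := ω) v m v'.length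
  obtain ⟨w', hl', hw'⟩ := exists_frac_add (ω := ω) v' m' v.length
  rw [hw, hw'] at h hne
  obtain rfl := hp.eq_of_length_eq (by omega) h
  rw [hp.frac_frac] at h
  exact ⟨_, _, fun he => hne (by rw [he]), h⟩

lemma offDiag_succ (hp : IsShiftKernel ω Λ p) {m m' : ℕ}
    (h : p (frac ω [] m) (frac ω [] m') ≠ 0) :
    ω m = ω m' ∧ p (frac ω [] (m + 1)) (frac ω [] (m' + 1)) ≠ 0 := by
  rw [← frac_succ, ← frac_succ [] m', List.nil_append, List.nil_append, ← gen_frac,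
    ← gen_frac] at h
  have hω := hp.eq_of_ne_zero _ _ _ _ h
  rw [hω, hp.gen_gen] at h
  exact ⟨hω, h⟩

lemma offDiag_add (hp : IsShiftKernel ω Λ p) {m m' : ℕ}
    (h : p (frac ω [] m) (frac ω [] m') ≠ 0) (j : ℕ) :
    p (frac ω [] (m + j)) (frac ω [] (m' + j)) ≠ 0 := by
  induction j with
  | zero => exact h
  | succ j ih => exact (hp.offDiag_succ ih).2

lemma eventuallyPeriodic (hp : IsShiftKernel ω Λ p) {m m' : ℕ} (hm : m ≠ m')
    (h : p (frac ω [] m) (frac ω [] m') ≠ 0) : EventuallyPeriodic ω := by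
  have key : ∀ j, ω (m + j) = ω (m' + j) := fun j => (hp.offDiag_succ (hp.offDiag_add h j)).1
  rcases lt_or_gt_of_ne hm with hlt | hlt
  · refine ⟨m, m' - m, by omega, fun a ha => ?_⟩
    have := key (a - m)
    rwa [Nat.add_sub_cancel' ha, show m' + (a - m) = a + (m' - m) by omega, eq_comm] at this
  · refine ⟨m', m - m', by omega, fun a ha => ?_⟩
    have := key (a - m')
    rwa [Nat.add_sub_cancel' ha, show m + (a - m') = a + (m - m') by omega] at this

lemma exists_weight_period (hp : IsShiftKernel ω Λ p) {m m' : ℕ} (hm : m ≠ m')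
    (h : p (frac ω [] m) (frac ω [] m') ≠ 0) :
    ∃ N d, 1 ≤ d ∧ ∀ v ≠ [], ∀ M ≥ N, Λ (frac ω v M) = Λ (frac ω v (M + d)) := by
  have key : ∀ v ≠ [], ∀ j, Λ (frac ω v (m + j)) = Λ (frac ω v (m' + j)) := by
    intro v hv j
    cases v with
    | nil => exact absurd rfl hv
    | cons i v =>
      rw [← gen_frac, ← gen_frac]
      apply hp.weight_eq
      rw [hp.frac_frac]
      exact hp.offDiag_add h j
  rcases lt_or_gt_of_ne hm with hlt | hlt
  · refine ⟨m, m' - m, by omega, fun v hv a ha => ?_⟩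
    have := key v hv (a - m)
    rwa [Nat.add_sub_cancel' ha, show m' + (a - m) = a + (m' - m) by omega] at this
  · refine ⟨m', m - m', by omega, fun v hv a ha => ?_⟩
    have := key v hv (a - m')
    rwa [Nat.add_sub_cancel' ha, show m + (a - m') = a + (m - m') by omega, eq_comm] at this

lemma diag_eq (hp : IsShiftKernel ω Λ p) (u : Fomega ω) :
    p u u = p (frac ω [] 0) (frac ω [] 0) := by
  obtain ⟨v, m, rfl⟩ := exists_eq_frac u
  rw [hp.frac_frac]
  induction m with
  | zero => rfl
  | succ m ih => rw [← hp.frac_frac ([] ++ [ω m]), frac_succ, ih]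

end IsShiftKernel

lemma weight_mul_listPow_eq {v₀ : List (Fin n)} (hv : IsPeriodicWord ω v₀) {N d : ℕ}
    (h : ∀ v ≠ [], ∀ M ≥ N, Λ (frac ω v M) = Λ (frac ω v (M + d))) (u : Fomega ω)
    (hu : u.1 * wordProd (listPow v₀ d) ∈ Fomega ω) :
    Λ ⟨u.1 * wordProd (listPow v₀ d), hu⟩ = Λ u := by
  obtain ⟨v, m, hne, rfl⟩ := exists_eq_frac_add u (N + d * v₀.length)
  have hm : N + d * v₀.length + m = N + m + d * v₀.length := by omega
  have key : ∀ k, Λ (frac ω v (N + m)) = Λ (frac ω v (N + m + d * k)) := by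
    intro k
    induction k with
    | zero => rfl
    | succ k ih => rw [ih, h v hne _ (by omega)]; congr 2; ring
  have hmul : (⟨_, hu⟩ : Fomega ω) = frac ω v (N + m) :=
    Subtype.ext (by simpa only [hm] using hv.frac_mul v d (N + m))
  rw [hmul, hm, key v₀.length]

lemma exists_reducing_of_perm (hT : IsWeightedShiftR ω Λ T) (σ : Equiv.Perm (Fomega ω))
    (hσ : ∀ u, σ u ≠ u) (hgen : ∀ i u, σ (gen ω i u) = gen ω i (σ u))
    (hΛ : ∀ u, Λ (σ u) = Λ u) :
    ∃ H : Submodule ℂ (Komega ω), IsClosed (H : Set (Komega ω)) ∧ H ≠ ⊥ ∧ H ≠ ⊤ ∧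
      ∀ i : Fin n, Reduces (T i) H := by
  obtain ⟨U, hU1, hU2, hU⟩ := exists_unitary_perm σ
  have hUT : ∀ i, Commute U (T i) := fun i => ext_xi fun u => by
    simp only [mul_apply_eq_comp]
    rw [hU, hT, hT, map_smul, hU, hgen, ← hgen, hΛ]
  have hUT' : ∀ i, Commute (star U) (T i) := fun i => by
    have := congrArg (fun X => star U * X * star U) (hUT i).eq
    simp only [← mul_assoc, hU1, one_mul] at this
    simp only [mul_assoc, hU2, mul_one] at this
    exact this.symm
  set A := U + star U with hA
  have hAs : IsSelfAdjoint A := IsSelfAdjoint.add_star_self U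
  have hAT : ∀ i, Commute A (T i) := fun i => (hUT i).add_left (hUT' i)
  have hAT' : ∀ i, Commute A (star (T i)) := fun i => by
    have := (hAT i).star_star
    rwa [hAs.star_eq] at this
  have hstar : ∀ u w, ⟪xi ω u, star U (xi ω w)⟫_ℂ = ⟪xi ω (σ u), xi ω w⟫_ℂ := fun u w => by
    rw [ContinuousLinearMap.star_eq_adjoint, ContinuousLinearMap.adjoint_inner_right, hU]
  have hdiag : ∀ u, ⟪xi ω u, A (xi ω u)⟫_ℂ = 0 := fun u => by
    rw [hA, add_apply, inner_add_right, hstar, hU, inner_xi_xi, inner_xi_xi,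
      if_neg (hσ u), if_neg (hσ u).symm, add_zero]
  have hA0 : A ≠ 0 := fun h0 => by
    have h1 : ⟪xi ω (σ (frac ω [] 0)), A (xi ω (frac ω [] 0))⟫_ℂ = 0 := by simp [h0]
    rw [hA, add_apply, inner_add_right, hstar, hU, inner_xi_xi, inner_xi_xi,
      if_pos rfl] at h1
    split_ifs at h1 <;> norm_num at h1
  obtain ⟨H, hcl, hbot, htop, hred⟩ :=
    exists_reducing_of_isSelfAdjoint dense_span_range_xi hAs hA0 hdiag
  exact ⟨H, hcl, hbot, htop, fun i => hred _ (hAT i) (hAT' i)⟩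

lemma exists_offDiag_of_reducing (hT : IsWeightedShiftR ω Λ T) (hpos : ∀ u, 0 < Λ u)
    {H : Submodule ℂ (Komega ω)} (hcl : IsClosed (H : Set (Komega ω))) (hbot : H ≠ ⊥)
    (htop : H ≠ ⊤) (hred : ∀ i, Reduces (T i) H) :
    ∃ p, IsShiftKernel ω Λ p ∧ ∃ m m', m ≠ m' ∧ p (frac ω [] m) (frac ω [] m') ≠ 0 := by
  have : CompleteSpace H := hcl.completeSpace_coe
  set P := H.starProjection
  have hp := hT.isShiftKernel hpos (P := P)
    (fun x y => Submodule.inner_starProjection_left_eq_right H x y)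
    (fun i x => starProjection_apply_of_reduces (hred i) x)
  refine ⟨_, hp, ?_⟩
  by_contra hcon
  have hoff : ∀ u u', u ≠ u' → ⟪xi ω u, P (xi ω u')⟫_ℂ = 0 := fun u u' hne => by
    by_contra h
    exact hcon (hp.exists_offDiag hne h)
  set c := ⟪xi ω (frac ω [] 0), P (xi ω (frac ω [] 0))⟫_ℂ
  have hPc : P = c • (1 : Komega ω →L[ℂ] Komega ω) := ext_xi fun u => ext_inner_xi fun w => by
    rw [smul_apply, one_apply_eq_self, inner_smul_right,
      inner_xi_xi]
    split_ifs with h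
    · rw [h, mul_one]
      exact hp.diag_eq u
    · rw [mul_zero, hoff w u h]
  obtain ⟨x, hx, hx0⟩ := (Submodule.ne_bot_iff H).1 hbot
  have hc : c = 1 := by
    have h1 : P x = x := Submodule.starProjection_eq_self_iff.2 hx
    rw [hPc, smul_apply, one_apply_eq_self] at h1
    have h2 : (c - 1) • x = 0 := by rw [sub_smul, one_smul, h1, sub_self]
    exact sub_eq_zero.1 ((smul_eq_zero.1 h2).resolve_right hx0)
  refine htop (Submodule.eq_top_iff'.2 fun y => ?_)
  rw [← Submodule.starProjection_eq_self_iff]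
  change P y = y
  rw [hPc, hc, one_smul, one_apply_eq_self]

end Shift

/-- Nikolskii-type theorem: a bilateral weighted shift (on `K_ω` with `ω`
aperiodic or periodic) has a non-trivial joint reducing subspace iff `ω` is periodic and
the weights are periodic: `λ_{u v₀^k} = λ_u` for some `k ≥ 1`. -/
theorem bilateral_weighted_shift_reducible_iff_doubly_periodic
    {n : ℕ} (hn : 2 ≤ n) (ω : ℕ → Fin n)
    (hω : Aperiodic ω ∨ ∃ v₀ : List (Fin n), Primitive v₀ ∧ IsPeriodicWord ω v₀)
    (Λ : Fomega ω → ℝ) (hbdd : ∃ C : ℝ, ∀ u, ‖Λ u‖ ≤ C) (hpos : ∀ u, 0 < Λ u)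
    (T : Fin n → Komega ω →L[ℂ] Komega ω) (hT : IsWeightedShiftR ω Λ T) :
    (∃ H : Submodule ℂ (Komega ω), IsClosed (H : Set (Komega ω)) ∧ H ≠ ⊥ ∧ H ≠ ⊤ ∧
        ∀ i : Fin n, Reduces (T i) H) ↔
      (∃ v₀ : List (Fin n), Primitive v₀ ∧ IsPeriodicWord ω v₀ ∧
        ∃ k : ℕ, 1 ≤ k ∧ ∀ (u : Fomega ω)
          (h : u.1 * wordProd (listPow v₀ k) ∈ Fomega ω),
          Λ ⟨u.1 * wordProd (listPow v₀ k), h⟩ = Λ u) := by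
  constructor
  · rintro ⟨H, hcl, hbot, htop, hred⟩
    obtain ⟨p, hp, m, m', hm, h⟩ := exists_offDiag_of_reducing hT hpos hcl hbot htop hred
    obtain hap | ⟨v₀, hprim, hper⟩ := hω
    · exact absurd (hp.eventuallyPeriodic hm h) hap
    · obtain ⟨N, d, hd, hΛ⟩ := hp.exists_weight_period hm h
      exact ⟨v₀, hprim, hper, d, hd, weight_mul_listPow_eq hper hΛ⟩
  · rintro ⟨v₀, -, hper, k, hk, hΛ⟩
    exact exists_reducing_of_perm hT (rightMulPerm hper k) (rightMulPerm_ne hper hk)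
      (rightMulPerm_gen hper k) fun u => hΛ u (hper.mul_mem k u)
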